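/- Fix real numbers a > 0 and A > −1, and define R(a,A;v) := ∑_{i=1}^∞ e^{−v·i^{a+1}}·i^A for v > 0. Then, as v → 0⁺, R(a,A;v) − (Γ((A+1)/(a+1))/(a+1))·v^{−(A+1)/(a+1)} − ζ(−A) = O(v), where Γ is the Gamma function and ζ(−A) denotes the value at −A of the analytic continuation of the Riemann zeta function. -/

import Mathlib

open Filter Asymptotics

/-- The function `x ↦ x ^ A * exp (-v * x ^ b)`. -/
noncomputable def powExp (b A v x : ℝ) : ℝ := x ^ A * Real.exp (-v * x ^ b)

/-- The value of `∫ x in Ioi 0, powExp b A v x` when `-1 < A`. -/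
noncomputable def powExpMass (b A v : ℝ) : ℝ :=
  Real.Gamma ((A + 1) / b) / b * v ^ (-(A + 1) / b)

/-- The sum of `powExp b A v` over the shifted lattice `ℕ + θ`. -/
noncomputable def powExpSum (b A v θ : ℝ) : ℝ := ∑' i : ℕ, powExp b A v (i + θ)

lemma powExp_nonneg (b A v : ℝ) {x : ℝ} (hx : 0 ≤ x) : 0 ≤ powExp b A v x := by
  unfold powExp; positivity

lemma exists_powExp_le_rpow {b v : ℝ} (A : ℝ) (hb : 0 < b) (hv : 0 < v) :
    ∃ C m : ℝ, 0 ≤ C ∧ 2 ≤ m ∧ ∀ x : ℝ, 0 < x → powExp b A v x ≤ C * x ^ (-m) := by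
  obtain ⟨n, hn⟩ := exists_nat_ge ((A + 2) / b)
  rw [div_le_iff₀ hb] at hn
  refine ⟨n.factorial / v ^ n, n * b - A, by positivity, by linarith, fun x hx => ?_⟩
  have hy : 0 < v * x ^ b := by positivity
  have h1 := Real.pow_div_factorial_le_exp (v * x ^ b) hy.le n
  have h2 : Real.exp (-v * x ^ b) ≤ n.factorial / (v * x ^ b) ^ n := by
    rw [neg_mul, Real.exp_neg, inv_le_comm₀ (Real.exp_pos _) (by positivity), inv_div]
    exact h1
  calc powExp b A v x ≤ x ^ A * (n.factorial / (v * x ^ b) ^ n) := by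
        unfold powExp; gcongr
    _ = _ := by
        rw [mul_pow, neg_sub, Real.rpow_sub hx, ← Real.rpow_natCast (x ^ b) n, ← Real.rpow_mul hx.le,
          mul_comm (n : ℝ) b]
        field_simp

lemma exists_summable_powExp_bound {b v p : ℝ} (A : ℝ) (hb : 0 < b) (hv : 0 < v) (hp : 0 < p)
    (hp1 : p ≤ 1) :
    ∃ u : ℕ → ℝ, Summable u ∧ ∀ (i : ℕ) (x : ℝ), p ≤ x → powExp b A v (i + x) ≤ u i := by
  obtain ⟨C, m, hC, hm, h⟩ := exists_powExp_le_rpow A hb hv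
  refine ⟨fun i => C * p ^ (-m) * ((i + 1 : ℕ) : ℝ) ^ (-m), ?_, fun i x hx => ?_⟩
  · refine Summable.mul_left _ ?_
    exact (summable_nat_add_iff 1).2 (Real.summable_nat_rpow.2 (by linarith))
  · have hi : (0 : ℝ) ≤ i := i.cast_nonneg
    have h1 : p * (i + 1) ≤ i + x := by nlinarith
    refine (h _ (by linarith)).trans ?_
    dsimp only
    rw [mul_assoc]
    refine mul_le_mul_of_nonneg_left ?_ hC
    push_cast
    rw [← Real.mul_rpow hp.le (by positivity)]
    exact Real.rpow_le_rpow_of_nonpos (by positivity) h1 (by linarith)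

lemma summable_powExp {b v θ : ℝ} (A : ℝ) (hb : 0 < b) (hv : 0 < v) (hθ : 0 < θ) :
    Summable fun i : ℕ => powExp b A v (i + θ) := by
  obtain ⟨u, hu, h⟩ := exists_summable_powExp_bound A hb hv (lt_min hθ one_pos) (min_le_right θ 1)
  exact hu.of_nonneg_of_le (fun i => powExp_nonneg _ _ _ (by positivity))
    fun i => h i θ (min_le_left _ _)

lemma hasDerivAt_powExp (b A v : ℝ) {x : ℝ} (hx : 0 < x) :
    HasDerivAt (powExp b A v) (A * powExp b (A - 1) v x - v * b * powExp b (A + b - 1) v x) x := by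
  have h1 := Real.hasDerivAt_rpow_const (p := A) (Or.inl hx.ne')
  have h2 := ((Real.hasDerivAt_rpow_const (p := b) (Or.inl hx.ne')).const_mul (-v)).exp
  convert! h1.mul h2 using 1
  rw [powExp, powExp, add_sub_assoc, Real.rpow_add hx]
  ring

lemma continuous_powExp {b A v : ℝ} (hb : 0 ≤ b) (hA : 0 ≤ A) :
    Continuous (powExp b A v) := by
  unfold powExp
  exact (Real.continuous_rpow_const hA).mul
    (Real.continuous_exp.comp (continuous_const.mul (Real.continuous_rpow_const hb)))

lemma hasDerivAt_powExpSum {b v θ : ℝ} (A : ℝ) (hb : 0 < b) (hv : 0 < v) (hθ : 0 < θ) :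
    HasDerivAt (powExpSum b A v)
      (A * powExpSum b (A - 1) v θ - v * b * powExpSum b (A + b - 1) v θ) θ := by
  have hp : 0 < min (θ / 2) 1 := lt_min (by linarith) one_pos
  obtain ⟨u, hu, h⟩ := exists_summable_powExp_bound (A - 1) hb hv hp (min_le_right _ _)
  obtain ⟨w, hw, h'⟩ := exists_summable_powExp_bound (A + b - 1) hb hv hp (min_le_right _ _)
  have key := hasDerivAt_tsum_of_isPreconnected (t := Set.Ioi (min (θ / 2) 1))
    (u := fun i => |A| * u i + v * b * w i) (y₀ := θ) (y := θ)
    (g := fun (i : ℕ) x => powExp b A v (i + x))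
    (g' := fun (i : ℕ) x => A * powExp b (A - 1) v (i + x) - v * b * powExp b (A + b - 1) v (i + x))
    ((hu.mul_left _).add (hw.mul_left _)) isOpen_Ioi isPreconnected_Ioi
    (fun i x hx => ?_) (fun i x hx => ?_) ?_ (summable_powExp A hb hv hθ) ?_
  · rw [Summable.tsum_sub ((summable_powExp (A - 1) hb hv hθ).mul_left _)
      ((summable_powExp (A + b - 1) hb hv hθ).mul_left _), tsum_mul_left, tsum_mul_left] at key
    exact key
  · have hx0 : 0 < (i : ℝ) + x := by have := hp.trans hx; positivity
    exact (hasDerivAt_powExp b A v hx0).comp_const_add (i : ℝ) x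
  · have hx0 : 0 ≤ (i : ℝ) + x := by have := hp.trans hx; positivity
    have e1 := powExp_nonneg b (A - 1) v hx0
    have e2 := powExp_nonneg b (A + b - 1) v hx0
    refine (norm_sub_le _ _).trans ?_
    rw [norm_mul, norm_mul, Real.norm_of_nonneg e1, Real.norm_of_nonneg e2,
      Real.norm_of_nonneg (by positivity : 0 ≤ v * b), Real.norm_eq_abs]
    have f1 := h i x (le_of_lt hx)
    have f2 := h' i x (le_of_lt hx)
    gcongr
  · exact (min_le_left _ _).trans_lt (half_lt_self hθ)
  · exact (min_le_left _ _).trans_lt (half_lt_self hθ)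

lemma integrableOn_powExp {b A v : ℝ} (hb : 0 < b) (hA : -1 < A) (hv : 0 < v) :
    MeasureTheory.IntegrableOn (powExp b A v) (Set.Ioi 0) :=
  integrableOn_rpow_mul_exp_neg_mul_rpow hA hb hv

lemma integral_powExp {b A v : ℝ} (hb : 0 < b) (hA : -1 < A) (hv : 0 < v) :
    ∫ x in Set.Ioi 0, powExp b A v x = powExpMass b A v := by
  simp only [powExp, powExpMass]
  rw [integral_rpow_mul_exp_neg_mul_rpow hb hA hv]
  ring

lemma intervalIntegrable_powExp {b A v : ℝ} (hb : 0 < b) (hA : -1 < A) (hv : 0 < v) (i : ℕ) :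
    IntervalIntegrable (fun t => powExp b A v (i + t)) MeasureTheory.volume 0 1 := by
  have h : IntervalIntegrable (powExp b A v) MeasureTheory.volume i (i + 1) := by
    rw [intervalIntegrable_iff_integrableOn_Ioc_of_le (by linarith)]
    refine (integrableOn_powExp hb hA hv).mono_set fun x hx => ?_
    exact lt_of_le_of_lt i.cast_nonneg hx.1
  have := h.comp_add_left (i : ℝ)
  simpa using this

lemma hasSum_integral_powExp {b A v : ℝ} (hb : 0 < b) (hA : -1 < A) (hv : 0 < v) :
    HasSum (fun i : ℕ => ∫ t in (0 : ℝ)..1, powExp b A v (i + t)) (powExpMass b A v) := by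
  rw [hasSum_iff_tendsto_nat_of_nonneg]
  · have h := MeasureTheory.intervalIntegral_tendsto_integral_Ioi 0
      (integrableOn_powExp hb hA hv) tendsto_natCast_atTop_atTop
    rw [integral_powExp hb hA hv] at h
    refine h.congr fun n => ?_
    have := intervalIntegral.sum_integral_adjacent_intervals (f := powExp b A v)
      (μ := MeasureTheory.volume) (a := fun k : ℕ => (k : ℝ)) (n := n) fun k _ => by
        rw [intervalIntegrable_iff_integrableOn_Ioc_of_le (by simp)]
        refine (integrableOn_powExp hb hA hv).mono_set fun x hx => ?_
        exact lt_of_le_of_lt k.cast_nonneg hx.1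
    simp only [Nat.cast_zero] at this
    rw [← this]
    refine Finset.sum_congr rfl fun k _ => ?_
    rw [intervalIntegral.integral_comp_add_left (powExp b A v)]
    simp
  · intro i
    refine intervalIntegral.integral_nonneg zero_le_one fun t ht => powExp_nonneg _ _ _ ?_
    have := ht.1
    positivity

lemma mul_powExpMass_sub_one {b A v : ℝ} (hb : 0 < b) (hA : 0 < A) (hv : 0 < v) :
    A * powExpMass b (A - 1) v = v * b * powExpMass b (A + b - 1) v := by
  have h1 : (A + b - 1 + 1) / b = A / b + 1 := by field_simp; ring
  have h2 : -(A + b - 1 + 1) / b = -A / b - 1 := by field_simp; ring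
  rw [powExpMass, powExpMass, h1, h2, Real.Gamma_add_one (by positivity), Real.rpow_sub_one hv.ne',
    sub_add_cancel]
  field_simp

lemma abs_powExpSum_sub_mass_le_mass {b A v θ : ℝ} (hb : 0 < b) (hA : 0 < A) (hv : 0 < v)
    (hθ : θ ∈ Set.Ioo (0 : ℝ) 1) :
    |powExpSum b A v θ - powExpMass b A v| ≤ 2 * A * powExpMass b (A - 1) v := by
  have i1 := intervalIntegrable_powExp hb (by linarith : -1 < A - 1) hv
  have i2 := intervalIntegrable_powExp hb (by linarith : -1 < A + b - 1) hv
  have hs1 := hasSum_integral_powExp hb (by linarith : -1 < A - 1) hv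
  have hs2 := hasSum_integral_powExp hb (by linarith : -1 < A + b - 1) hv
  have hs := (hs1.mul_left A).add (hs2.mul_left (v * b))
  rw [← mul_powExpMass_sub_one hb hA hv, ← two_mul, ← mul_assoc] at hs
  have hf := (summable_powExp A hb hv hθ.1).hasSum.sub
    (hasSum_integral_powExp hb (by linarith : -1 < A) hv)
  rw [← Real.norm_eq_abs]
  refine hf.norm_le_of_bounded hs fun i => ?_
  have hi : (0 : ℝ) ≤ i := i.cast_nonneg
  set G : ℝ → ℝ := fun t => A * powExp b (A - 1) v (i + t) + v * b * powExp b (A + b - 1) v (i + t)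
    with hG
  have hGi : IntervalIntegrable G MeasureTheory.volume 0 1 :=
    ((i1 i).const_mul A).add ((i2 i).const_mul (v * b))
  have hGint : ∫ t in (0 : ℝ)..1, G t = A * (∫ t in (0 : ℝ)..1, powExp b (A - 1) v (i + t)) +
      v * b * ∫ t in (0 : ℝ)..1, powExp b (A + b - 1) v (i + t) := by
    rw [intervalIntegral.integral_add ((i1 i).const_mul A) ((i2 i).const_mul (v * b)),
      intervalIntegral.integral_const_mul, intervalIntegral.integral_const_mul]
  have hG0 : ∀ t, 0 ≤ t → 0 ≤ G t := fun t ht =>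
    add_nonneg (mul_nonneg hA.le (powExp_nonneg _ _ _ (by positivity)))
      (mul_nonneg (by positivity) (powExp_nonneg _ _ _ (by positivity)))
  rw [← hGint]
  have hcont : Continuous fun t : ℝ => powExp b A v (i + t) :=
    (continuous_powExp hb.le hA.le).comp (continuous_const.add continuous_id)
  have hle : ∀ x y : ℝ, 0 ≤ x → x ≤ y → y ≤ 1 →
      |powExp b A v (i + y) - powExp b A v (i + x)| ≤ ∫ t in (0 : ℝ)..1, G t := by
    intro x y hx hxy hy
    have hsub : Set.uIcc x y ⊆ Set.uIcc 0 1 := by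
      rw [Set.uIcc_of_le hxy, Set.uIcc_of_le zero_le_one]; exact Set.Icc_subset_Icc hx hy
    have := intervalIntegral.integral_eq_sub_of_hasDerivAt_of_le hxy hcont.continuousOn
      (f' := fun t => A * powExp b (A - 1) v (i + t) - v * b * powExp b (A + b - 1) v (i + t))
      (fun t ht => (hasDerivAt_powExp b A v
        (by have := hx.trans_lt ht.1; positivity)).comp_const_add (i : ℝ) t)
      ((((i1 i).const_mul A).sub ((i2 i).const_mul (v * b))).mono_set hsub)
    rw [← this, ← Real.norm_eq_abs]
    refine (intervalIntegral.norm_integral_le_of_norm_le hxy (g := G) (.of_forall fun t ht => ?_)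
      (hGi.mono_set hsub)).trans ?_
    · have ht0 : 0 ≤ (i : ℝ) + t := by have := hx.trans_lt ht.1; positivity
      have e1 := powExp_nonneg b (A - 1) v ht0
      have e2 := powExp_nonneg b (A + b - 1) v ht0
      refine (norm_sub_le _ _).trans ?_
      rw [Real.norm_of_nonneg (mul_nonneg hA.le e1), Real.norm_of_nonneg (by positivity)]
    · refine intervalIntegral.integral_mono_interval hx hxy hy ?_ hGi
      filter_upwards [MeasureTheory.ae_restrict_mem measurableSet_Ioc] with t ht using hG0 t ht.1.le
  have hconst : powExp b A v (i + θ) - ∫ t in (0 : ℝ)..1, powExp b A v (i + t) =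
      ∫ t in (0 : ℝ)..1, (powExp b A v (i + θ) - powExp b A v (i + t)) := by
    rw [intervalIntegral.integral_sub intervalIntegrable_const (hcont.intervalIntegrable _ _)]
    simp
  rw [hconst]
  refine (intervalIntegral.norm_integral_le_of_norm_le_const
    (C := ∫ t in (0 : ℝ)..1, G t) fun t ht => ?_).trans (by simp)
  rw [Set.uIoc_of_le zero_le_one] at ht
  rw [Real.norm_eq_abs]
  rcases le_total t θ with h | h
  · exact hle t θ ht.1.le h hθ.2.le
  · rw [abs_sub_comm]; exact hle θ t hθ.1.le h ht.2

lemma abs_powExpSum_sub_mass_le_of_deriv {b A v M : ℝ} (hb : 0 < b) (hA : 0 < A) (hv : 0 < v)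
    (hM : ∀ θ ∈ Set.Ioo (0 : ℝ) 1,
      |A * powExpSum b (A - 1) v θ - v * b * powExpSum b (A + b - 1) v θ| ≤ M)
    {θ : ℝ} (hθ : θ ∈ Set.Ioo (0 : ℝ) 1) :
    |powExpSum b A v θ - powExpMass b A v| ≤ M := by
  have hM0 : 0 ≤ M := (abs_nonneg _).trans (hM θ hθ)
  have hA1 : -1 < A := by linarith
  have hdiff : ∀ t ∈ Set.Ioo (0 : ℝ) 1, |powExpSum b A v θ - powExpSum b A v t| ≤ M := by
    intro t ht
    have := Convex.norm_image_sub_le_of_norm_hasDerivWithin_le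
      (fun x hx => (hasDerivAt_powExpSum A hb hv hx.1).hasDerivWithinAt) hM (convex_Ioo 0 1) ht hθ
    refine this.trans ?_
    have : ‖θ - t‖ ≤ 1 := by
      rw [Real.norm_eq_abs, abs_le]; constructor <;> linarith [ht.1, ht.2, hθ.1, hθ.2]
    nlinarith
  have hint := intervalIntegrable_powExp hb hA1 hv
  have hsw := MeasureTheory.hasSum_integral_of_summable_integral_norm
    (μ := MeasureTheory.volume.restrict (Set.Ioo (0 : ℝ) 1))
    (F := fun (i : ℕ) t => powExp b A v (i + t)) (fun i => ?_) ?_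
  · have h1 : ∫ t in Set.Ioo (0 : ℝ) 1, powExpSum b A v t = powExpMass b A v := by
      refine hsw.unique ?_
      convert! hasSum_integral_powExp hb hA1 hv using 2 with i
      rw [intervalIntegral.integral_of_le zero_le_one, MeasureTheory.integral_Ioc_eq_integral_Ioo]
    have hc : MeasureTheory.IntegrableOn (powExpSum b A v) (Set.Ioo (0 : ℝ) 1) := by
      refine MeasureTheory.IntegrableOn.of_bound (by simp) ?_ (|powExpSum b A v θ| + M) ?_
      · refine ContinuousOn.aestronglyMeasurable ?_ measurableSet_Ioo
        intro t ht
        exact (hasDerivAt_powExpSum A hb hv ht.1).continuousAt.continuousWithinAt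
      · filter_upwards [MeasureTheory.ae_restrict_mem measurableSet_Ioo] with t ht
        have := hdiff t ht
        rw [abs_sub_comm] at this
        rw [Real.norm_eq_abs]
        linarith [abs_sub_abs_le_abs_sub (powExpSum b A v t) (powExpSum b A v θ)]
    have h2 : powExpSum b A v θ - powExpMass b A v =
        ∫ t in Set.Ioo (0 : ℝ) 1, (powExpSum b A v θ - powExpSum b A v t) := by
      rw [MeasureTheory.integral_sub (by simp) hc, h1]
      simp
    rw [h2, ← Real.norm_eq_abs]
    refine (MeasureTheory.norm_setIntegral_le_of_norm_le_const (C := M) (by simp) hdiff).trans ?_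
    simp
  · have := hint i
    rwa [intervalIntegrable_iff_integrableOn_Ioo_of_le zero_le_one] at this
  · convert! (hasSum_integral_powExp hb hA1 hv).summable using 2 with i
    rw [intervalIntegral.integral_of_le zero_le_one, MeasureTheory.integral_Ioc_eq_integral_Ioo]
    refine MeasureTheory.setIntegral_congr_fun measurableSet_Ioo fun t ht => ?_
    have := ht.1
    exact Real.norm_of_nonneg (powExp_nonneg _ _ _ (by positivity))

lemma exists_abs_powExpSum_sub_mass_le {b : ℝ} (hb : 0 < b) (k : ℕ) :
    ∀ A : ℝ, k < A → ∃ C : ℝ, ∀ v > 0, ∀ θ ∈ Set.Ioo (0 : ℝ) 1,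
      |powExpSum b A v θ - powExpMass b A v| ≤ C * v ^ (-(A - k) / b) := by
  induction k with
  | zero =>
    intro A hA
    simp only [Nat.cast_zero] at hA
    refine ⟨2 * A * (Real.Gamma (A / b) / b), fun v hv θ hθ => ?_⟩
    refine (abs_powExpSum_sub_mass_le_mass hb hA hv hθ).trans (le_of_eq ?_)
    simp [powExpMass]
    ring
  | succ k ih =>
    intro A hA
    push_cast at hA
    have hk : (0 : ℝ) ≤ k := k.cast_nonneg
    have hA0 : 0 < A := by linarith
    obtain ⟨C₁, h₁⟩ := ih (A - 1) (by linarith)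
    obtain ⟨C₂, h₂⟩ := ih (A + b - 1) (by linarith)
    refine ⟨A * C₁ + b * C₂, fun v hv θ hθ => ?_⟩
    refine abs_powExpSum_sub_mass_le_of_deriv hb hA0 hv (fun t ht => ?_) hθ
    have e1 := h₁ v hv t ht
    have e2 := h₂ v hv t ht
    have e3 : v * v ^ (-(A + b - 1 - k) / b) = v ^ (-(A - ((k + 1 : ℕ) : ℝ)) / b) := by
      rw [← Real.rpow_one_add' hv.le]
      · congr 1; push_cast; field_simp; ring
      · have : 1 + -(A + b - 1 - k) / b = -(A - 1 - k) / b := by field_simp; ring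
        rw [this]
        exact div_ne_zero (by linarith) hb.ne'
    have e4 : -(A - ((k + 1 : ℕ) : ℝ)) / b = -(A - 1 - k) / b := by push_cast; ring
    have hm := mul_powExpMass_sub_one hb hA0 hv
    calc _ = |A * (powExpSum b (A - 1) v t - powExpMass b (A - 1) v) -
          v * b * (powExpSum b (A + b - 1) v t - powExpMass b (A + b - 1) v)| := by
            congr 1; linear_combination hm
      _ ≤ A * (C₁ * v ^ (-(A - 1 - k) / b)) +
          v * b * (C₂ * v ^ (-(A + b - 1 - k) / b)) := by
            refine (abs_sub _ _).trans ?_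
            rw [abs_mul, abs_mul, abs_of_pos hA0, abs_of_pos (by positivity : 0 < v * b)]
            gcongr
      _ = _ := by rw [add_mul, ← e4, ← e3]; ring

lemma exists_abs_powExpSum_one_sub_mass_le {b A : ℝ} (hb : 0 < b) (hA : 0 < A) :
    ∃ C : ℝ, ∀ v ∈ Set.Ioc (0 : ℝ) 1,
      |powExpSum b A v 1 - powExpMass b A v| ≤ C * v ^ (-(1 / b)) := by
  obtain ⟨k, hk⟩ : ∃ k : ℕ, ⌈A⌉₊ = k + 1 :=
    Nat.exists_eq_succ_of_ne_zero (Nat.ceil_pos.2 hA).ne'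
  have hk1 : (k : ℝ) < A := Nat.lt_ceil.1 (by omega)
  have hk2 : A ≤ k + 1 := by exact_mod_cast hk ▸ Nat.le_ceil A
  obtain ⟨C, hC⟩ := exists_abs_powExpSum_sub_mass_le hb k A hk1
  refine ⟨|C|, fun v hv => ?_⟩
  have hlim : Tendsto (fun θ => |powExpSum b A v θ - powExpMass b A v|)
      (nhdsWithin 1 (Set.Iio 1)) (nhds |powExpSum b A v 1 - powExpMass b A v|) :=
    (((hasDerivAt_powExpSum A hb hv.1 one_pos).continuousAt.tendsto.sub_const _).abs).mono_left
      nhdsWithin_le_nhds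
  refine le_of_tendsto hlim ?_
  filter_upwards [Ioo_mem_nhdsLT (zero_lt_one' ℝ)] with θ hθ
  refine (hC v hv.1 θ hθ).trans ?_
  have h1 : v ^ (-(A - k) / b) ≤ v ^ (-(1 / b)) := by
    refine Real.rpow_le_rpow_of_exponent_ge hv.1 hv.2 ?_
    rw [← neg_div]
    gcongr
    linarith
  have := Real.rpow_nonneg hv.1.le (-(A - k) / b)
  gcongr
  exact le_abs_self C

lemma hasDerivAt_powExpSum_param {b v θ : ℝ} (A : ℝ) (hb : 0 < b) (hv : 0 < v) (hθ : 0 < θ) :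
    HasDerivAt (fun v => powExpSum b A v θ) (-powExpSum b (A + b) v θ) v := by
  have key := hasDerivAt_tsum_of_isPreconnected (t := Set.Ioi (v / 2))
    (u := fun i : ℕ => powExp b (A + b) (v / 2) (i + θ)) (y₀ := v) (y := v)
    (g := fun (i : ℕ) v => powExp b A v (i + θ))
    (g' := fun (i : ℕ) v => -powExp b (A + b) v (i + θ))
    (summable_powExp _ hb (by linarith) hθ) isOpen_Ioi isPreconnected_Ioi
    (fun i x hx => ?_) (fun i x hx => ?_) (half_lt_self hv) (summable_powExp A hb hv hθ)
    (half_lt_self hv)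
  · rw [tsum_neg] at key
    exact key
  · have hi : 0 < (i : ℝ) + θ := by positivity
    have := (((hasDerivAt_id x).neg.mul_const (((i : ℝ) + θ) ^ b)).exp).const_mul (((i : ℝ) + θ) ^ A)
    convert! this using 1
    rw [powExp, Real.rpow_add hi]
    simp
    ring
  · have hi : 0 < (i : ℝ) + θ := by positivity
    rw [norm_neg, Real.norm_of_nonneg (powExp_nonneg _ _ _ hi.le)]
    have : v / 2 ≤ x := le_of_lt hx
    unfold powExp
    gcongr

lemma hasDerivAt_powExpMass {b A v : ℝ} (hb : 0 < b) (hA : -1 < A) (hv : 0 < v) :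
    HasDerivAt (powExpMass b A) (-powExpMass b (A + b) v) v := by
  have h := (Real.hasDerivAt_rpow_const (p := -(A + 1) / b) (Or.inl hv.ne')).const_mul
    (Real.Gamma ((A + 1) / b) / b)
  convert! h using 1
  have h1 : (A + b + 1) / b = (A + 1) / b + 1 := by field_simp; ring
  have h2 : -(A + b + 1) / b = -(A + 1) / b - 1 := by field_simp; ring
  have h3 : 0 < A + 1 := by linarith
  rw [powExpMass, h1, h2, Real.Gamma_add_one (by positivity)]
  ring

/-- A function on `(0, 1]` whose derivative is bounded by an integrable power has a limit at `0`. -/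
lemma exists_abs_sub_le_rpow_of_deriv_le {f f' : ℝ → ℝ} {C s : ℝ} (hs : s < 1)
    (hf : ∀ v ∈ Set.Ioc (0 : ℝ) 1, HasDerivAt f (f' v) v)
    (hf' : ∀ v ∈ Set.Ioc (0 : ℝ) 1, |f' v| ≤ C * v ^ (-s)) :
    ∃ c : ℝ, ∀ v ∈ Set.Ioc (0 : ℝ) 1, |f v - c| ≤ C / (1 - s) * v ^ (1 - s) := by
  have hs' : 0 < 1 - s := by linarith
  have hC : 0 ≤ C := by
    have := (abs_nonneg _).trans (hf' 1 ⟨one_pos, le_rfl⟩)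
    simpa using this
  set P : ℝ → ℝ := fun v => C / (1 - s) * v ^ (1 - s) with hP
  have hP0 : ∀ v ∈ Set.Ioc (0 : ℝ) 1, 0 ≤ P v := fun v hv => by have := hv.1; positivity
  have hPd : ∀ v ∈ Set.Ioc (0 : ℝ) 1, HasDerivAt P (C * v ^ (-s)) v := by
    intro v hv
    convert! (Real.hasDerivAt_rpow_const (p := 1 - s) (Or.inl hv.1.ne')).const_mul (C / (1 - s))
      using 1
    rw [show 1 - s - 1 = -s by ring]
    field_simp
  have hmono : MonotoneOn (fun v => f v + P v) (Set.Ioc 0 1) := by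
    refine monotoneOn_of_hasDerivWithinAt_nonneg (convex_Ioc 0 1)
      (fun v hv => ((hf v hv).add (hPd v hv)).continuousAt.continuousWithinAt)
      (fun v hv => ((hf v (interior_subset hv)).add (hPd v (interior_subset hv))).hasDerivWithinAt)
      (fun v hv => ?_)
    linarith [neg_abs_le (f' v), hf' v (interior_subset hv)]
  have hanti : AntitoneOn (fun v => f v - P v) (Set.Ioc 0 1) := by
    refine antitoneOn_of_hasDerivWithinAt_nonpos (convex_Ioc 0 1)
      (fun v hv => ((hf v hv).sub (hPd v hv)).continuousAt.continuousWithinAt)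
      (fun v hv => ((hf v (interior_subset hv)).sub (hPd v (interior_subset hv))).hasDerivWithinAt)
      (fun v hv => ?_)
    linarith [le_abs_self (f' v), hf' v (interior_subset hv)]
  have hle : ∀ v ∈ Set.Ioc (0 : ℝ) 1, ∀ w ∈ Set.Ioc (0 : ℝ) 1, f v - P v ≤ f w + P w := by
    intro v hv w hw
    have hm : min v w ∈ Set.Ioc (0 : ℝ) 1 := ⟨lt_min hv.1 hw.1, (min_le_left _ _).trans hv.2⟩
    have h1 := hanti hm hv (min_le_left _ _)
    have h2 := hmono hm hw (min_le_right _ _)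
    have := hP0 _ hm
    dsimp only at h1 h2
    linarith
  have h1 : (1 : ℝ) ∈ Set.Ioc (0 : ℝ) 1 := ⟨one_pos, le_rfl⟩
  refine ⟨sSup ((fun v => f v - P v) '' Set.Ioc 0 1), fun v hv => ?_⟩
  have hub : sSup ((fun v => f v - P v) '' Set.Ioc 0 1) ≤ f v + P v :=
    csSup_le ⟨_, Set.mem_image_of_mem _ h1⟩ (by rintro _ ⟨w, hw, rfl⟩; exact hle w hw v hv)
  have hlb : f v - P v ≤ sSup ((fun v => f v - P v) '' Set.Ioc 0 1) :=
    le_csSup ⟨f 1 + P 1, by rintro _ ⟨w, hw, rfl⟩; exact hle w hw 1 h1⟩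
      (Set.mem_image_of_mem _ hv)
  rw [abs_le]
  constructor <;> linarith

lemma exists_abs_powExpSum_sub_mass_sub_le {b A : ℝ} (hb : 1 < b) (hA : -1 < A) :
    ∃ c C : ℝ, ∀ v ∈ Set.Ioc (0 : ℝ) 1,
      |powExpSum b A v 1 - powExpMass b A v - c| ≤ C * v := by
  have hb0 : 0 < b := by linarith
  have hderiv : ∀ B, -1 < B → ∀ v ∈ Set.Ioc (0 : ℝ) 1,
      HasDerivAt (fun v => powExpSum b B v 1 - powExpMass b B v)
        (-(powExpSum b (B + b) v 1 - powExpMass b (B + b) v)) v := by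
    intro B hB v hv
    convert! (hasDerivAt_powExpSum_param B hb0 hv.1 one_pos).sub
      (hasDerivAt_powExpMass hb0 hB hv.1) using 1
    ring
  have hs : 1 / b < 1 := (div_lt_one hb0).2 hb
  have hbdd : ∀ B, -1 < B → ∃ C : ℝ, ∀ v ∈ Set.Ioc (0 : ℝ) 1,
      |powExpSum b B v 1 - powExpMass b B v| ≤ C := by
    intro B hB
    obtain ⟨C, hC⟩ := exists_abs_powExpSum_one_sub_mass_le (A := B + b) hb0 (by linarith)
    obtain ⟨c, hc⟩ := exists_abs_sub_le_rpow_of_deriv_le hs (hderiv B hB)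
      (fun v hv => by rw [abs_neg]; exact hC v hv)
    have hC0 : 0 ≤ C := by
      have := (abs_nonneg _).trans (hC 1 ⟨one_pos, le_rfl⟩)
      simpa using this
    refine ⟨|c| + C / (1 - 1 / b), fun v hv => ?_⟩
    have h1 := hc v hv
    have h2 : v ^ (1 - 1 / b) ≤ 1 := Real.rpow_le_one hv.1.le hv.2 (by linarith)
    have h3 : C / (1 - 1 / b) * v ^ (1 - 1 / b) ≤ C / (1 - 1 / b) :=
      mul_le_of_le_one_right (div_nonneg hC0 (by linarith)) h2
    have h4 := abs_sub_abs_le_abs_sub (powExpSum b B v 1 - powExpMass b B v) c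
    linarith
  obtain ⟨C, hC⟩ := hbdd (A + b) (by linarith)
  obtain ⟨c, hc⟩ := exists_abs_sub_le_rpow_of_deriv_le (s := 0) (C := C) one_pos (hderiv A hA)
    (fun v hv => by rw [abs_neg]; simpa using hC v hv)
  exact ⟨c, C, fun v hv => by simpa using hc v hv⟩

lemma mellin_powExpSum {b A : ℝ} (hb : 0 < b) {s : ℂ} (hs0 : 0 < s.re) (hs : A + 1 < b * s.re) :
    mellin (fun v => (powExpSum b A v 1 : ℂ)) s =
      Complex.Gamma s * riemannZeta (b * s - A) := by
  have hpos : ∀ i : ℕ, (0 : ℝ) < (i : ℝ) + 1 := fun i => by positivity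
  have key := hasSum_mellin (a := fun i : ℕ => ((((i : ℝ) + 1) ^ A : ℝ) : ℂ))
    (p := fun i : ℕ => ((i : ℝ) + 1) ^ b) (F := fun v => (powExpSum b A v 1 : ℂ)) (s := s)
    (fun i => Or.inr (by have := hpos i; positivity)) hs0 (fun t ht => ?_) ?_
  · rw [← key.tsum_eq, zeta_eq_tsum_one_div_nat_add_one_cpow, ← tsum_mul_left]
    · refine tsum_congr fun i => ?_
      have hi : ((i : ℂ) + 1) ≠ 0 := by exact_mod_cast (hpos i).ne'
      rw [Complex.ofReal_cpow (hpos i).le, Complex.cpow_sub _ _ hi,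
        show (((((i : ℝ) + 1) ^ b : ℝ) : ℂ)) ^ s = ((i : ℂ) + 1) ^ (b * s) by
          rw [Complex.cpow_def_of_ne_zero (by exact_mod_cast (Real.rpow_pos_of_pos (hpos i) b).ne'),
            ← Complex.ofReal_log (Real.rpow_pos_of_pos (hpos i) b).le, Real.log_rpow (hpos i),
            Complex.cpow_def_of_ne_zero hi]
          push_cast
          rw [Complex.ofReal_log (hpos i).le]
          push_cast
          ring_nf]
      push_cast
      field_simp
    · simp
      linarith
  · convert! Complex.hasSum_ofReal.2 (summable_powExp A hb ht one_pos).hasSum using 2 with i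
    rw [powExp, ← Complex.ofReal_mul, neg_mul, neg_mul, mul_comm t]
  · have : Summable fun i : ℕ => ((i + 1 : ℕ) : ℝ) ^ (A - b * s.re) :=
      (summable_nat_add_iff 1).2 (Real.summable_nat_rpow.2 (by linarith))
    refine this.congr fun i => ?_
    have hi := hpos i
    push_cast
    rw [Complex.norm_real, Real.norm_of_nonneg (by positivity), Real.rpow_sub hi,
      Real.rpow_mul hi.le]

lemma powExpSum_isBigO_atTop {b : ℝ} (A a : ℝ) (hb : 0 < b) :
    (fun v => powExpSum b A v 1) =O[atTop] fun v : ℝ => v ^ (-a) := by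
  have h1 : (fun v => powExpSum b A v 1) =O[atTop] fun v : ℝ => Real.exp (-1 * v) := by
    refine IsBigO.of_bound (Real.exp 1 * powExpSum b A 1 1) ?_
    filter_upwards [eventually_ge_atTop 1] with v hv
    have hs : ∀ w > 0, Summable fun i : ℕ => powExp b A w (i + 1) :=
      fun w hw => summable_powExp A hb hw one_pos
    have h0 : 0 ≤ powExpSum b A v 1 := tsum_nonneg fun i => powExp_nonneg _ _ _ (by positivity)
    rw [Real.norm_of_nonneg h0, Real.norm_of_nonneg (Real.exp_pos _).le, powExpSum, powExpSum,
      mul_right_comm, ← Real.exp_add, ← tsum_mul_left]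
    refine (hs v (by linarith)).tsum_le_tsum (fun i => ?_) ((hs 1 one_pos).mul_left _)
    have h2 : (1 : ℝ) ≤ ((i : ℝ) + 1) ^ b := Real.one_le_rpow (by simp) hb.le
    rw [powExp, powExp, mul_left_comm, ← Real.exp_add]
    gcongr
    nlinarith
  exact h1.trans (isLittleO_exp_neg_mul_rpow_atTop one_pos _).isBigO

lemma powExpSum_limit_eq_riemannZeta {b A c C : ℝ} (hb : 0 < b) (hA : -1 < A)
    (hc : ∀ v ∈ Set.Ioc (0 : ℝ) 1, |powExpSum b A v 1 - powExpMass b A v - c| ≤ C * v) :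
    riemannZeta (-A) = c := by
  set σ : ℝ := (A + 1) / b with hσ
  have hσ0 : 0 < σ := div_pos (by linarith) hb
  have hσb : b * σ = A + 1 := by rw [hσ]; field_simp
  set m : ℝ := Real.Gamma ((A + 1) / b) / b with hm
  set h₁ : ℝ → ℂ := (Set.Ioc 0 1).indicator fun t : ℝ => (t : ℂ) ^ (-σ : ℂ) with hh₁
  set h₂ : ℝ → ℂ := (Set.Ioc 0 1).indicator fun _ => 1 with hh₂
  set F : ℝ → ℂ := fun v => (powExpSum b A v 1 : ℂ) with hF
  set g : ℝ → ℂ := fun v => F v - ((m : ℂ) • h₁ v + (c : ℂ) • h₂ v) with hg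
  have hgtop : ∀ v : ℝ, 1 < v → g v = F v := fun v hv => by simp [hg, hh₁, hh₂, hv]
  have hgbot : ∀ v ∈ Set.Ioc (0 : ℝ) 1,
      g v = ((powExpSum b A v 1 - powExpMass b A v - c : ℝ) : ℂ) := fun v hv => by
    simp only [hg, hh₁, hh₂, hF, Set.indicator_of_mem hv, powExpMass]
    rw [neg_div, ← hσ, ← hm]
    push_cast
    rw [Complex.ofReal_cpow hv.1.le]
    push_cast
    simp
    ring
  have hloc : MeasureTheory.LocallyIntegrableOn g (Set.Ioi 0) := by
    have e0 : MeasureTheory.LocallyIntegrableOn F (Set.Ioi 0) := by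
      refine ContinuousOn.locallyIntegrableOn (fun v hv => ?_) measurableSet_Ioi
      exact (Complex.continuous_ofReal.continuousAt.comp
        (hasDerivAt_powExpSum_param A hb hv one_pos).continuousAt).continuousWithinAt
    have e1 : ∀ f : ℝ → ℂ, ContinuousOn f (Set.Ioi 0) →
        MeasureTheory.LocallyIntegrableOn ((Set.Ioc 0 1).indicator f) (Set.Ioi 0) := by
      intro f hf
      rw [MeasureTheory.locallyIntegrableOn_iff isOpen_Ioi.isLocallyClosed]
      intro k hk hkc
      exact ((hf.mono hk).integrableOn_compact hkc).indicator measurableSet_Ioc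
    refine e0.sub (((e1 _ fun t ht => ?_).smul (m : ℂ)).add ((e1 _ continuousOn_const).smul (c : ℂ)))
    exact (Complex.continuousAt_ofReal_cpow_const t _ (Or.inr ht.ne')).continuousWithinAt
  have htop : ∀ a : ℝ, g =O[atTop] fun v : ℝ => v ^ (-a) := by
    intro a
    refine IsBigO.congr' (Complex.isBigO_ofReal_left.2 (powExpSum_isBigO_atTop A a hb)) ?_
      EventuallyEq.rfl
    filter_upwards [eventually_gt_atTop 1] with v hv using (hgtop v hv).symm
  have hbot : g =O[nhdsWithin 0 (Set.Ioi 0)] fun v : ℝ => v ^ (-(-1) : ℝ) := by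
    refine IsBigO.of_bound C ?_
    filter_upwards [Ioc_mem_nhdsGT (zero_lt_one' ℝ)] with v hv
    rw [hgbot v hv, Complex.norm_real, neg_neg, Real.rpow_one, Real.norm_of_nonneg hv.1.le]
    exact hc v hv
  have hgd : ∀ s : ℂ, -1 < s.re → DifferentiableAt ℂ (mellin g) s := fun s hs =>
    mellin_differentiableAt_of_isBigO_rpow hloc (htop (s.re + 1)) (by linarith) hbot hs
  have hmellin : ∀ s : ℂ, σ < s.re →
      Complex.Gamma s * riemannZeta (b * s - A) = mellin g s + (m * (1 / (s - σ)) + c * (1 / s)) := by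
    intro s hs
    have hs0 : 0 < s.re := hσ0.trans hs
    have hgc : MellinConvergent g s :=
      mellinConvergent_of_isBigO_rpow hloc (htop (s.re + 1)) (by linarith) hbot (by linarith)
    have k1 := hasMellin_cpow_Ioc (-σ : ℂ) (s := s) (by simpa using hs)
    have k2 := hasMellin_one_Ioc hs0
    have k3 := hasMellin_add (hasMellin_const_smul k1.1 (m : ℂ)).1 (hasMellin_const_smul k2.1 (c : ℂ)).1
    have k4 := (hasMellin_add hgc k3.1).2
    rw [k3.2, (hasMellin_const_smul k1.1 (m : ℂ)).2, (hasMellin_const_smul k2.1 (c : ℂ)).2,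
      k1.2, k2.2] at k4
    rw [← mellin_powExpSum hb hs0 (by rw [← hσb]; gcongr)]
    convert! k4 using 2
    · ext v; simp [hg, hF, hh₁, hh₂]
  -- The pole of the zeta function at `1` is removed by the factor `w - 1`.
  set Z : ℂ → ℂ := Function.update (fun w => (w - 1) * riemannZeta w) 1 1 with hZ
  have hZne : ∀ w, w ≠ 1 → Z w = (w - 1) * riemannZeta w := fun w hw => by
    simp [hZ, hw]
  have hZd : Differentiable ℂ Z := by
    intro w
    by_cases hw : w = 1
    · subst hw
      refine (Complex.analyticAt_of_differentiable_on_punctured_nhds_of_continuousAt ?_ ?_).differentiableAt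
      · filter_upwards [self_mem_nhdsWithin] with w hw
        refine DifferentiableAt.congr_of_eventuallyEq
          ((differentiableAt_id.sub_const 1).mul (differentiableAt_riemannZeta hw)) ?_
        filter_upwards [isOpen_ne.mem_nhds hw] with z hz using hZne z hz
      · exact continuousAt_update_same.2 riemannZeta_residue_one
    · refine DifferentiableAt.congr_of_eventuallyEq
        ((differentiableAt_id.sub_const 1).mul (differentiableAt_riemannZeta hw)) ?_
      filter_upwards [isOpen_ne.mem_nhds hw] with z hz using hZne z hz
  set U : Set ℂ := {s | -1 < s.re} with hU
  have hUo : IsOpen U := isOpen_lt continuous_const Complex.continuous_re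
  have hUc : IsPreconnected U := (convex_halfSpace_re_gt (-1)).isPreconnected
  have hbC : (b : ℂ) ≠ 0 := by exact_mod_cast hb.ne'
  have hσbC : (b : ℂ) * σ = A + 1 := by exact_mod_cast hσb
  have heq : Set.EqOn (fun s => Complex.Gamma (s + 1) * Z (b * s - A))
      (fun s => b * (s * (s - σ) * mellin g s + (m * s + c * (s - σ)))) U := by
    refine AnalyticOnNhd.eqOn_of_preconnected_of_eventuallyEq (z₀ := ((σ + 1 : ℝ) : ℂ))
      (DifferentiableOn.analyticOnNhd (fun s hs => DifferentiableAt.differentiableWithinAt ?_) hUo)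
      (DifferentiableOn.analyticOnNhd (fun s hs => DifferentiableAt.differentiableWithinAt ?_) hUo)
      hUc ?_ ?_
    · refine DifferentiableAt.mul ?_ ?_
      · refine (Complex.differentiableAt_Gamma (s + 1) fun n hn => ?_).comp s (by fun_prop)
        have := congrArg Complex.re hn
        simp at this
        have h1 : -1 < s.re := hs
        have h2 : (0 : ℝ) ≤ n := n.cast_nonneg
        linarith
      · exact (hZd _).comp s (by fun_prop)
    · have := hgd s hs
      fun_prop
    · simp [hU]
      linarith
    · have : {s : ℂ | σ < s.re} ∈ nhds ((σ + 1 : ℝ) : ℂ) :=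
        (isOpen_lt continuous_const Complex.continuous_re).mem_nhds (by simp)
      filter_upwards [this] with s hs
      have hs : σ < s.re := hs
      have hs0 : s ≠ 0 := fun h => by simp [h] at hs; linarith
      have hsσ : s - σ ≠ 0 := fun h => by
        have := congrArg Complex.re h
        simp at this
        linarith
      have hw : b * s - A - 1 = b * (s - σ) := by linear_combination hσbC
      have hw1 : b * s - A ≠ 1 := fun h => mul_ne_zero hbC hsσ (by rw [← hw, h, sub_self])
      rw [hZne _ hw1, hw, Complex.Gamma_add_one s hs0]
      have := hmellin s hs
      calc _ = b * (s * (s - σ)) * (Complex.Gamma s * riemannZeta (b * s - A)) := by ring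
        _ = _ := by rw [this]; field_simp
  have h0 := heq (show (0 : ℂ) ∈ U by simp [hU])
  have hA1 : -(A : ℂ) ≠ 1 := fun h => by
    have : -A = 1 := by exact_mod_cast h
    linarith
  simp only [mul_zero, zero_sub, zero_add, Complex.Gamma_one, one_mul, zero_mul] at h0
  rw [hZne _ hA1] at h0
  have hne : (-(A : ℂ) - 1) ≠ 0 := sub_ne_zero.2 hA1
  refine mul_left_cancel₀ hne (h0.trans ?_)
  linear_combination (-c : ℂ) * hσbC

/-- For `a > 0` and `A > −1`, the exponential sum
`R(a,A;v) = ∑_{i=1}^∞ e^(−v·i^(a+1))·i^A` satisfies, as `v → 0⁺`,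
`R(a,A;v) − (Γ((A+1)/(a+1))/(a+1))·v^(−(A+1)/(a+1)) − ζ(−A) = O(v)`. -/
theorem silicosis_R_asymptotics (a A : ℝ) (ha : 0 < a) (hA : -1 < A)
    (R : ℝ → ℝ)
    (hR : ∀ v : ℝ, R v =
      ∑' i : ℕ, Real.exp (-v * ((i + 1 : ℕ) : ℝ) ^ (a + 1)) * ((i + 1 : ℕ) : ℝ) ^ A) :
    (fun v : ℝ =>
        R v - (Real.Gamma ((A + 1) / (a + 1)) / (a + 1)) * v ^ (-(A + 1) / (a + 1)) -
          (riemannZeta (-(A : ℂ))).re)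
      =O[nhdsWithin 0 (Set.Ioi 0)] fun v : ℝ => v := by
  obtain ⟨c, C, hc⟩ := exists_abs_powExpSum_sub_mass_sub_le (b := a + 1) (by linarith) hA
  rw [powExpSum_limit_eq_riemannZeta (by linarith) hA hc, Complex.ofReal_re]
  refine IsBigO.of_bound C ?_
  filter_upwards [Ioc_mem_nhdsGT (zero_lt_one' ℝ)] with v hv
  have hRv : R v = powExpSum (a + 1) A v 1 := by
    rw [hR, powExpSum]
    refine tsum_congr fun i => ?_
    rw [powExp, mul_comm]
    push_cast
    rfl
  rw [hRv, Real.norm_of_nonneg hv.1.le]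
  exact hc v hv
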